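/- arXiv:2006.02520 — 4 statements merged into one kernel-verified Lean document; each statement's English description precedes it below -/
import Mathlib

section
/- Let (J^ℱ,(f_n)) and (J^𝒢,(g_n)) be two unimodal nonautonomous discrete dynamical systems, both satisfying the limit property. Then (J^ℱ,(f_n)) and (J^𝒢,(g_n)) are topologically conjugate if and only if they have the same kneading sequence. -/
open Set

noncomputable section

/-- The nonautonomous iterate `f_n^ℓ = f_{n+ℓ-1} ∘ ⋯ ∘ f_n` (and `f_n^0 = id`). -/
def iterFrom (f : ℕ → ℝ → ℝ) : ℕ → ℕ → ℝ → ℝ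
  | _, 0, x => x
  | n, ℓ + 1, x => f (n + ℓ) (iterFrom f n ℓ x)

/-- `(Icc a b, (f n))` is a unimodal nonautonomous discrete dynamical system with
turning points `c n`. -/
def IsUNDS (a b : ℝ) (f : ℕ → ℝ → ℝ) (c : ℕ → ℝ) : Prop :=
  a < b ∧ ∀ n : ℕ,
    ContinuousOn (f n) (Icc a b) ∧
    MapsTo (f n) (Icc a b) (Icc a b) ∧
    f n a = a ∧ f n b = a ∧
    c n ∈ Ioo a b ∧
    StrictMonoOn (f n) (Icc a (c n)) ∧
    StrictAntiOn (f n) (Icc (c n) b)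

/-- The two systems have the same kneading sequence. -/
def SameKneading (f : ℕ → ℝ → ℝ) (cF : ℕ → ℝ) (g : ℕ → ℝ → ℝ) (cG : ℕ → ℝ) : Prop :=
  ∀ n ℓ : ℕ,
    (iterFrom f n ℓ (cF n) < cF (n + ℓ) ↔ iterFrom g n ℓ (cG n) < cG (n + ℓ)) ∧
    (iterFrom f n ℓ (cF n) = cF (n + ℓ) ↔ iterFrom g n ℓ (cG n) = cG (n + ℓ))

/-- `𝒞_n(ℱ)`: points of `Icc a b` eventually mapped onto a turning point. -/
def critSet (a b : ℝ) (f : ℕ → ℝ → ℝ) (c : ℕ → ℝ) (n : ℕ) : Set ℝ :=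
  {x ∈ Icc a b | ∃ ℓ : ℕ, iterFrom f n ℓ x = c (n + ℓ)}

/-- A (single) unimodal map on `Icc a b` with turning point `cg`. -/
def IsUnimodal (a b : ℝ) (g : ℝ → ℝ) (cg : ℝ) : Prop :=
  ContinuousOn g (Icc a b) ∧ MapsTo g (Icc a b) (Icc a b) ∧
  g a = a ∧ g b = a ∧ cg ∈ Ioo a b ∧
  StrictMonoOn g (Icc a cg) ∧ StrictAntiOn g (Icc cg b)

/-- `𝒞(g)` for an autonomous unimodal map `g`. -/
def critSetMap (a b : ℝ) (g : ℝ → ℝ) (cg : ℝ) : Set ℝ :=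
  {x ∈ Icc a b | ∃ ℓ : ℕ, g^[ℓ] x = cg}

/-- The limit property for a UNDS. -/
def LimitProperty (a b : ℝ) (f : ℕ → ℝ → ℝ) (c : ℕ → ℝ) : Prop :=
  ∃ (g : ℝ → ℝ) (cg : ℝ),
    IsUnimodal a b g cg ∧
    (∀ m : ℕ, 1 ≤ m → g^[m] cg ≠ cg) ∧
    TendstoUniformlyOn (fun n => f n) g Filter.atTop (Icc a b) ∧
    (∀ n : ℕ, Icc a b ⊆ closure (critSet a b f c n)) ∧
    Icc a b ⊆ closure (critSetMap a b g cg)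

/-- Topological conjugacy of two NDS on compact intervals: a sequence of order-preserving
homeomorphisms `h n : Icc aF bF → Icc aG bG`, equicontinuous together with their inverses,
intertwining the dynamics. -/
def TopConjugate (aF bF aG bG : ℝ) (f g : ℕ → ℝ → ℝ) : Prop :=
  ∃ h : ℕ → ℝ → ℝ,
    (∀ n, StrictMonoOn (h n) (Icc aF bF)) ∧
    (∀ n, ContinuousOn (h n) (Icc aF bF)) ∧
    (∀ n, BijOn (h n) (Icc aF bF) (Icc aG bG)) ∧
    (∀ ε > (0:ℝ), ∃ δ > (0:ℝ), ∀ n, ∀ x ∈ Icc aF bF, ∀ y ∈ Icc aF bF,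
      |x - y| < δ → |h n x - h n y| < ε) ∧
    (∀ ε > (0:ℝ), ∃ δ > (0:ℝ), ∀ n, ∀ x ∈ Icc aF bF, ∀ y ∈ Icc aF bF,
      |h n x - h n y| < δ → |x - y| < ε) ∧
    (∀ n, ∀ x ∈ Icc aF bF, h (n + 1) (f n x) = g n (h n x))

open Filter Topology

namespace UnimodalNDS

theorem iterFrom_succ' (f : ℕ → ℝ → ℝ) (n ℓ : ℕ) (x : ℝ) :
    iterFrom f n (ℓ + 1) x = iterFrom f (n + 1) ℓ (f n x) := by
  induction ℓ with
  | zero => simp [iterFrom]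
  | succ k ih =>
    rw [iterFrom, ih, iterFrom]
    congr 1
    omega

/-- The itineraries of `x` under `f` and of `y` under `g`, started at time `n`, agree. -/
def SameItinerary (f : ℕ → ℝ → ℝ) (cF : ℕ → ℝ) (g : ℕ → ℝ → ℝ) (cG : ℕ → ℝ)
    (n : ℕ) (x y : ℝ) : Prop :=
  ∀ ℓ : ℕ,
    (iterFrom f n ℓ x < cF (n + ℓ) ↔ iterFrom g n ℓ y < cG (n + ℓ)) ∧
    (iterFrom f n ℓ x = cF (n + ℓ) ↔ iterFrom g n ℓ y = cG (n + ℓ))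

section Itinerary

variable {a b a' b' : ℝ} {f g : ℕ → ℝ → ℝ} {cF cG : ℕ → ℝ} {n : ℕ} {x y x₁ x₂ y₁ y₂ : ℝ}

theorem SameItinerary.symm (h : SameItinerary f cF g cG n x y) :
    SameItinerary g cG f cF n y x :=
  fun ℓ => ⟨(h ℓ).1.symm, (h ℓ).2.symm⟩

theorem SameItinerary.shift (h : SameItinerary f cF g cG n x y) :
    SameItinerary f cF g cG (n + 1) (f n x) (g n y) := by
  intro ℓ
  have := h (ℓ + 1)
  rwa [iterFrom_succ', iterFrom_succ', show n + (ℓ + 1) = n + 1 + ℓ by omega] at this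

theorem SameItinerary.of_shift (h : SameItinerary f cF g cG (n + 1) (f n x) (g n y))
    (h0 : (x < cF n ↔ y < cG n) ∧ (x = cF n ↔ y = cG n)) :
    SameItinerary f cF g cG n x y := by
  intro ℓ
  cases ℓ with
  | zero => exact h0
  | succ k =>
    have := h k
    rwa [iterFrom_succ', iterFrom_succ', show n + (k + 1) = n + 1 + k by omega]

theorem iterFrom_mem (hF : IsUNDS a b f cF) (hx : x ∈ Icc a b) (ℓ : ℕ) :
    iterFrom f n ℓ x ∈ Icc a b := by
  induction ℓ with
  | zero => exact hx
  | succ k ih => exact (hF.2 (n + k)).2.1 ih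

theorem continuousOn_iterFrom (hF : IsUNDS a b f cF) (n ℓ : ℕ) :
    ContinuousOn (iterFrom f n ℓ) (Icc a b) := by
  induction ℓ with
  | zero => exact continuousOn_id
  | succ k ih =>
    exact (hF.2 (n + k)).1.comp ih fun x hx => iterFrom_mem hF hx k

/-- Unequal itineraries determine the order of two points. -/
theorem lt_iff_lt_of_itinerary_ne (hF : IsUNDS a b f cF) (hG : IsUNDS a' b' g cG) (ℓ : ℕ) :
    ∀ {n : ℕ} {x₁ x₂ y₁ y₂ : ℝ}, x₁ ∈ Icc a b → x₂ ∈ Icc a b → y₁ ∈ Icc a' b' → y₂ ∈ Icc a' b' →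
      SameItinerary f cF g cG n x₁ y₁ → SameItinerary f cF g cG n x₂ y₂ →
      ¬ ((iterFrom f n ℓ x₁ < cF (n + ℓ) ↔ iterFrom f n ℓ x₂ < cF (n + ℓ)) ∧
        (iterFrom f n ℓ x₁ = cF (n + ℓ) ↔ iterFrom f n ℓ x₂ = cF (n + ℓ))) →
      (x₁ < x₂ ↔ y₁ < y₂) := by
  induction ℓ with
  | zero =>
    intro n x₁ x₂ y₁ y₂ _ _ _ _ h₁ h₂ hne
    have h₁ := h₁ 0
    have h₂ := h₂ 0
    simp only [iterFrom, add_zero] at h₁ h₂ hne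
    grind
  | succ k ih =>
    intro n x₁ x₂ y₁ y₂ hx₁ hx₂ hy₁ hy₂ h₁ h₂ hne
    have e₁ := h₁ 0
    have e₂ := h₂ 0
    simp only [iterFrom, add_zero] at e₁ e₂
    rw [iterFrom_succ', iterFrom_succ', show n + (k + 1) = n + 1 + k by omega] at hne
    obtain ⟨-, mf, -, -, -, incf, decf⟩ := hF.2 n
    obtain ⟨-, mg, -, -, -, incg, decg⟩ := hG.2 n
    have ih₁ := ih (mf hx₁) (mf hx₂) (mg hy₁) (mg hy₂) h₁.shift h₂.shift hne
    have ih₂ := ih (mf hx₂) (mf hx₁) (mg hy₂) (mg hy₁) h₂.shift h₁.shift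
      (fun h => hne ⟨h.1.symm, h.2.symm⟩)
    rcases lt_trichotomy x₁ (cF n) with l₁ | l₁ | l₁ <;>
      rcases lt_trichotomy x₂ (cF n) with l₂ | l₂ | l₂
    · rw [← incf.lt_iff_lt ⟨hx₁.1, l₁.le⟩ ⟨hx₂.1, l₂.le⟩, ih₁,
        incg.lt_iff_lt ⟨hy₁.1, (e₁.1.1 l₁).le⟩ ⟨hy₂.1, (e₂.1.1 l₂).le⟩]
    · grind
    · grind
    · grind
    · exact absurd (by simp [l₁, l₂]) hne
    · grind
    · grind
    · grind
    · have k₁ : cG n ≤ y₁ := by grind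
      have k₂ : cG n ≤ y₂ := by grind
      rw [← decf.lt_iff_gt ⟨l₂.le, hx₂.2⟩ ⟨l₁.le, hx₁.2⟩, ih₂,
        decg.lt_iff_gt ⟨k₂, hy₂.2⟩ ⟨k₁, hy₁.2⟩]

/-- Points separated by a precritical point have different itineraries. -/
theorem not_sameItinerary_of_between (hF : IsUNDS a b f cF) (ℓ : ℕ) :
    ∀ {n : ℕ} {x z y : ℝ}, x ∈ Icc a b → y ∈ Icc a b → x < z → z < y →
      iterFrom f n ℓ z = cF (n + ℓ) → ¬ SameItinerary f cF f cF n x y := by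
  induction ℓ with
  | zero =>
    intro n x z y _ _ hxz hzy hz h
    have h := h 0
    simp only [iterFrom, add_zero] at h hz
    grind
  | succ k ih =>
    intro n x z y hx hy hxz hzy hz h
    have e := h 0
    simp only [iterFrom, add_zero] at e
    rw [iterFrom_succ', show n + (k + 1) = n + 1 + k by omega] at hz
    obtain ⟨-, mf, -, -, -, incf, decf⟩ := hF.2 n
    rcases lt_trichotomy x (cF n) with l | l | l
    · have l' := e.1.1 l
      exact ih (mf hx) (mf hy)
        (incf ⟨hx.1, l.le⟩ ⟨by linarith [hx.1], by linarith⟩ hxz)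
        (incf ⟨by linarith [hx.1], by linarith⟩ ⟨hy.1, l'.le⟩ hzy) hz h.shift
    · linarith [e.2.1 l]
    · have l' : cF n < y := by linarith
      exact ih (mf hy) (mf hx)
        (decf ⟨by linarith, by linarith [hy.2]⟩ ⟨l'.le, hy.2⟩ hzy)
        (decf ⟨l.le, hx.2⟩ ⟨by linarith, by linarith [hy.2]⟩ hxz) hz h.shift.symm

theorem exists_mem_Ioo_of_dense {S : Set ℝ} (hS : Icc a b ⊆ closure S) {u v : ℝ}
    (hu : a ≤ u) (hv : v ≤ b) (huv : u < v) : ∃ z ∈ S, z ∈ Ioo u v := by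
  obtain ⟨m, hm⟩ := exists_between huv
  obtain ⟨z, hz, hzS⟩ := mem_closure_iff.1 (hS ⟨by linarith [hm.1], by linarith [hm.2]⟩)
    (Ioo u v) isOpen_Ioo hm
  exact ⟨z, hzS, hz⟩

theorem lt_of_lt_of_sameItinerary (hF : IsUNDS a b f cF) (hG : IsUNDS a' b' g cG)
    (hd : Icc a b ⊆ closure (critSet a b f cF n))
    (hx₁ : x₁ ∈ Icc a b) (hx₂ : x₂ ∈ Icc a b) (hy₁ : y₁ ∈ Icc a' b') (hy₂ : y₂ ∈ Icc a' b')
    (h₁ : SameItinerary f cF g cG n x₁ y₁) (h₂ : SameItinerary f cF g cG n x₂ y₂)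
    (hlt : x₁ < x₂) : y₁ < y₂ := by
  obtain ⟨z, ⟨-, ℓ, hz⟩, hz₁, hz₂⟩ := exists_mem_Ioo_of_dense hd hx₁.1 hx₂.2 hlt
  have hne := not_sameItinerary_of_between hF ℓ hx₁ hx₂ hz₁ hz₂ hz
  rw [SameItinerary, not_forall] at hne
  obtain ⟨m, hm⟩ := hne
  exact (lt_iff_lt_of_itinerary_ne hF hG m hx₁ hx₂ hy₁ hy₂ h₁ h₂ hm).1 hlt

/-- Systems with the same kneading sequence realise the same itineraries of precritical points. -/
theorem exists_sameItinerary (hF : IsUNDS a b f cF) (hG : IsUNDS a' b' g cG)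
    (hd : ∀ n, Icc a b ⊆ closure (critSet a b f cF n))
    (hk : SameKneading f cF g cG) (ℓ : ℕ) :
    ∀ {n : ℕ} {x : ℝ}, x ∈ Icc a b → iterFrom f n ℓ x = cF (n + ℓ) →
      ∃ y ∈ Icc a' b', SameItinerary f cF g cG n x y := by
  induction ℓ with
  | zero =>
    intro n x _ hx
    simp only [iterFrom, add_zero] at hx
    exact ⟨cG n, Ioo_subset_Icc_self (hG.2 n).2.2.2.2.1, hx ▸ hk n⟩
  | succ k ih =>
    intro n x hx hxc
    obtain ⟨-, mf, -, -, cf, incf, decf⟩ := hF.2 n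
    obtain ⟨contg, mg, ga, gb, cg, incg, decg⟩ := hG.2 n
    have cf' := Ioo_subset_Icc_self cf
    have cg' := Ioo_subset_Icc_self cg
    rw [iterFrom_succ', show n + (k + 1) = n + 1 + k by omega] at hxc
    obtain ⟨w, hw, hxw⟩ := ih (mf hx) hxc
    have hcc : SameItinerary f cF g cG n (cF n) (cG n) := hk n
    have key := lt_of_lt_of_sameItinerary hF hG (hd (n + 1)) (mf hx) (mf cf') hw (mg cg') hxw
      hcc.shift
    rcases lt_trichotomy x (cF n) with l | l | l
    · have hlt := key (incf ⟨hx.1, l.le⟩ ⟨cf'.1, le_rfl⟩ l)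
      obtain ⟨y, hy, rfl⟩ := intermediate_value_Icc cg'.1
        (contg.mono (Icc_subset_Icc_right cg'.2)) (show w ∈ _ from ⟨ga.symm ▸ hw.1, hlt.le⟩)
      have hyc : y < cG n := lt_of_le_of_ne hy.2 (by rintro rfl; exact lt_irrefl _ hlt)
      exact ⟨y, ⟨hy.1, hy.2.trans cg'.2⟩, hxw.of_shift ⟨by simp [l, hyc], by simp [l.ne, hyc.ne]⟩⟩
    · exact ⟨cG n, cg', l ▸ hcc⟩
    · have hlt := key (decf ⟨le_rfl, cf'.2⟩ ⟨l.le, hx.2⟩ l)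
      obtain ⟨y, hy, rfl⟩ := intermediate_value_Icc' cg'.2
        (contg.mono (Icc_subset_Icc_left cg'.1)) (show w ∈ _ from ⟨gb.symm ▸ hw.1, hlt.le⟩)
      have hyc : cG n < y := lt_of_le_of_ne hy.1 (by rintro rfl; exact lt_irrefl _ hlt)
      exact ⟨y, ⟨cg'.1.trans hy.1, hy.2⟩,
        hxw.of_shift ⟨by simp [l.not_gt, hyc.not_gt], by simp [l.ne', hyc.ne']⟩⟩

theorem iterFrom_left (hF : IsUNDS a b f cF) (n ℓ : ℕ) : iterFrom f n ℓ a = a := by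
  induction ℓ with
  | zero => rfl
  | succ k ih => rw [iterFrom, ih, (hF.2 (n + k)).2.2.1]

theorem sameItinerary_left (hF : IsUNDS a b f cF) (hG : IsUNDS a' b' g cG) (n : ℕ) :
    SameItinerary f cF g cG n a a' := by
  intro ℓ
  have h₁ := (hF.2 (n + ℓ)).2.2.2.2.1.1
  have h₂ := (hG.2 (n + ℓ)).2.2.2.2.1.1
  rw [iterFrom_left hF, iterFrom_left hG]
  exact ⟨by simp [h₁, h₂], by simp [h₁.ne, h₂.ne]⟩

end Itinerary

section Extension

variable {a b a' b' : ℝ}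

/-- The monotone extension to the whole interval of an order-preserving relation. -/
def monoExt (a b a' b' : ℝ) (R : ℝ → ℝ → Prop) (x : ℝ) : ℝ :=
  sSup {y ∈ Icc a' b' | ∃ z ∈ Icc a b, z ≤ x ∧ R z y}

variable {R : ℝ → ℝ → Prop}

theorem le_monoExt {x z y : ℝ} (hz : z ∈ Icc a b) (hy : y ∈ Icc a' b') (hzx : z ≤ x)
    (h : R z y) : y ≤ monoExt a b a' b' R x :=
  le_csSup ⟨b', fun _ hw => hw.1.2⟩ ⟨hy, z, hz, hzx, h⟩

theorem monoExt_le
    (hlt : ∀ x ∈ Icc a b, ∀ x' ∈ Icc a b, ∀ y ∈ Icc a' b', ∀ y' ∈ Icc a' b',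
      R x y → R x' y' → (x < x' ↔ y < y'))
    (hab : a ≤ b) (hab' : a' ≤ b') (ha : R a a') {x z y : ℝ} (hx : a ≤ x)
    (hz : z ∈ Icc a b) (hy : y ∈ Icc a' b') (hxz : x ≤ z) (h : R z y) :
    monoExt a b a' b' R x ≤ y := by
  refine csSup_le ⟨a', left_mem_Icc.2 hab', a, left_mem_Icc.2 hab, hx, ha⟩ ?_
  rintro w ⟨hw, v, hv, hvx, hR⟩
  by_contra! hlt'
  linarith [(hlt z hz v hv y hy w hw h hR).2 hlt']

theorem monoExt_eq
    (hlt : ∀ x ∈ Icc a b, ∀ x' ∈ Icc a b, ∀ y ∈ Icc a' b', ∀ y' ∈ Icc a' b',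
      R x y → R x' y' → (x < x' ↔ y < y'))
    (hab : a ≤ b) (hab' : a' ≤ b') (ha : R a a') {z y : ℝ}
    (hz : z ∈ Icc a b) (hy : y ∈ Icc a' b') (h : R z y) : monoExt a b a' b' R z = y :=
  (monoExt_le hlt hab hab' ha hz.1 hz hy le_rfl h).antisymm (le_monoExt hz hy le_rfl h)

theorem monoExt_mem (hab : a ≤ b) (hab' : a' ≤ b') (ha : R a a') {x : ℝ} (hx : a ≤ x) :
    monoExt a b a' b' R x ∈ Icc a' b' :=
  ⟨le_monoExt (left_mem_Icc.2 hab) (left_mem_Icc.2 hab') hx ha,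
    csSup_le ⟨a', left_mem_Icc.2 hab', a, left_mem_Icc.2 hab, hx, ha⟩ fun _ hw => hw.1.2⟩

theorem strictMonoOn_monoExt
    (hlt : ∀ x ∈ Icc a b, ∀ x' ∈ Icc a b, ∀ y ∈ Icc a' b', ∀ y' ∈ Icc a' b',
      R x y → R x' y' → (x < x' ↔ y < y'))
    (hab : a ≤ b) (hab' : a' ≤ b') (ha : R a a')
    (hd : Icc a b ⊆ closure {x ∈ Icc a b | ∃ y ∈ Icc a' b', R x y}) :
    StrictMonoOn (monoExt a b a' b' R) (Icc a b) := by
  intro x₁ hx₁ x₂ hx₂ h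
  obtain ⟨z₁, ⟨hz₁, y₁, hy₁, hR₁⟩, hl₁, hr₁⟩ := exists_mem_Ioo_of_dense hd hx₁.1 hx₂.2 h
  obtain ⟨z₂, ⟨hz₂, y₂, hy₂, hR₂⟩, hl₂, hr₂⟩ := exists_mem_Ioo_of_dense hd hz₁.1 hx₂.2 hr₁
  calc monoExt a b a' b' R x₁ ≤ y₁ := monoExt_le hlt hab hab' ha hx₁.1 hz₁ hy₁ hl₁.le hR₁
    _ < y₂ := (hlt _ hz₁ _ hz₂ _ hy₁ _ hy₂ hR₁ hR₂).1 hl₂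
    _ ≤ _ := le_monoExt hz₂ hy₂ hr₂.le hR₂

theorem eqOn_id_of_eq_on_dense {k : ℝ → ℝ} (hk : StrictMonoOn k (Icc a b))
    (hm : MapsTo k (Icc a b) (Icc a b)) {S : Set ℝ} (hS : Icc a b ⊆ closure S)
    (hSk : ∀ x ∈ S, k x = x) : ∀ x ∈ Icc a b, k x = x := by
  intro x hx
  have hkx := hm hx
  rcases lt_trichotomy (k x) x with h | h | h
  · obtain ⟨z, hz, hz₁, hz₂⟩ := exists_mem_Ioo_of_dense hS hkx.1 hx.2 h
    have := hk ⟨by linarith [hkx.1], by linarith [hx.2]⟩ hx hz₂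
    linarith [hSk z hz]
  · exact h
  · obtain ⟨z, hz, hz₁, hz₂⟩ := exists_mem_Ioo_of_dense hS hx.1 hkx.2 h
    have := hk hx ⟨by linarith [hx.1], by linarith [hkx.2]⟩ hz₁
    linarith [hSk z hz]

theorem exists_strictMonoOn_extension
    (hlt : ∀ x ∈ Icc a b, ∀ x' ∈ Icc a b, ∀ y ∈ Icc a' b', ∀ y' ∈ Icc a' b',
      R x y → R x' y' → (x < x' ↔ y < y'))
    (hab : a ≤ b) (hab' : a' ≤ b') (ha : R a a')
    (hd : Icc a b ⊆ closure {x ∈ Icc a b | ∃ y ∈ Icc a' b', R x y})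
    (hd' : Icc a' b' ⊆ closure {y ∈ Icc a' b' | ∃ x ∈ Icc a b, R x y}) :
    ∃ h k : ℝ → ℝ, StrictMonoOn h (Icc a b) ∧ StrictMonoOn k (Icc a' b') ∧
      MapsTo h (Icc a b) (Icc a' b') ∧ MapsTo k (Icc a' b') (Icc a b) ∧
      (∀ x ∈ Icc a b, k (h x) = x) ∧ (∀ y ∈ Icc a' b', h (k y) = y) ∧
      ∀ x ∈ Icc a b, ∀ y ∈ Icc a' b', R x y → h x = y := by
  have hlt' : ∀ y ∈ Icc a' b', ∀ y' ∈ Icc a' b', ∀ x ∈ Icc a b, ∀ x' ∈ Icc a b,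
      flip R y x → flip R y' x' → (y < y' ↔ x < x') :=
    fun y hy y' hy' x hx x' hx' h h' => (hlt x hx x' hx' y hy y' hy' h h').symm
  have eq₁ := fun x hx y hy hR => monoExt_eq (z := x) (y := y) hlt hab hab' ha hx hy hR
  have eq₂ := fun x hx y hy (hR : R x y) =>
    monoExt_eq (z := y) (y := x) hlt' hab' hab ha hy hx hR
  have m₁ := strictMonoOn_monoExt hlt hab hab' ha hd
  have m₂ := strictMonoOn_monoExt hlt' hab' hab ha hd'
  have t₁ : MapsTo (monoExt a b a' b' R) (Icc a b) (Icc a' b') :=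
    fun x hx => monoExt_mem hab hab' ha hx.1
  have t₂ : MapsTo (monoExt a' b' a b (flip R)) (Icc a' b') (Icc a b) :=
    fun x hx => monoExt_mem hab' hab ha hx.1
  refine ⟨_, _, m₁, m₂, t₁, t₂, ?_, ?_, eq₁⟩
  · refine eqOn_id_of_eq_on_dense (m₂.comp m₁ t₁) (t₂.comp t₁) hd ?_
    rintro x ⟨hx, y, hy, hR⟩
    simp only [eq₁ x hx y hy hR, eq₂ x hx y hy hR]
  · refine eqOn_id_of_eq_on_dense (m₁.comp m₂ t₂) (t₁.comp t₂) hd' ?_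
    rintro y ⟨hy, x, hx, hR⟩
    simp only [eq₁ x hx y hy hR, eq₂ x hx y hy hR]

theorem continuousOn_of_strictMonoOn_of_surjOn {h : ℝ → ℝ}
    (hm : StrictMonoOn h (Icc a b)) (ht : MapsTo h (Icc a b) (Icc a' b'))
    (hs : SurjOn h (Icc a b) (Icc a' b')) : ContinuousOn h (Icc a b) := by
  rw [continuousOn_iff_continuous_domRestrict]
  have hmono : Monotone (ht.restrict h _ _) := fun x y hxy => hm.monotoneOn x.2 y.2 hxy
  exact continuous_subtype_val.comp
    (hmono.continuous_of_surjective (ht.restrict_surjective_iff.2 hs))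

end Extension

/-- The family of monotone bijections matching the precritical points of two systems. -/
theorem exists_conjugating_family {a b a' b' : ℝ} {f g : ℕ → ℝ → ℝ} {cF cG : ℕ → ℝ}
    (hF : IsUNDS a b f cF) (hG : IsUNDS a' b' g cG)
    (hdF : ∀ n, Icc a b ⊆ closure (critSet a b f cF n))
    (hdG : ∀ n, Icc a' b' ⊆ closure (critSet a' b' g cG n))
    (hk : SameKneading f cF g cG) (n : ℕ) :
    ∃ h k : ℝ → ℝ, StrictMonoOn h (Icc a b) ∧ StrictMonoOn k (Icc a' b') ∧
      MapsTo h (Icc a b) (Icc a' b') ∧ MapsTo k (Icc a' b') (Icc a b) ∧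
      (∀ x ∈ Icc a b, k (h x) = x) ∧ (∀ y ∈ Icc a' b', h (k y) = y) ∧
      ∀ x ∈ Icc a b, ∀ y ∈ Icc a' b', SameItinerary f cF g cG n x y → h x = y := by
  have hk' : SameKneading g cG f cF := fun n ℓ => ⟨(hk n ℓ).1.symm, (hk n ℓ).2.symm⟩
  refine exists_strictMonoOn_extension ?_ hF.1.le hG.1.le (sameItinerary_left hF hG n) ?_ ?_
  · intro x hx x' hx' y hy y' hy' h h'
    exact ⟨lt_of_lt_of_sameItinerary hF hG (hdF n) hx hx' hy hy' h h',
      lt_of_lt_of_sameItinerary hG hF (hdG n) hy hy' hx hx' h.symm h'.symm⟩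
  · refine (hdF n).trans (closure_mono ?_)
    rintro x ⟨hx, ℓ, hxc⟩
    exact ⟨hx, exists_sameItinerary hF hG hdF hk ℓ hx hxc⟩
  · refine (hdG n).trans (closure_mono ?_)
    rintro y ⟨hy, ℓ, hyc⟩
    obtain ⟨x, hx, h⟩ := exists_sameItinerary hG hF hdG hk' ℓ hy hyc
    exact ⟨hy, x, hx, h.symm⟩

section Limit

variable {a b : ℝ} {f : ℕ → ℝ → ℝ} {cF : ℕ → ℝ} {φ : ℝ → ℝ} {c : ℝ}

theorem lt_apply_turning {ψ : ℝ → ℝ} {d x : ℝ} (h : IsUnimodal a b ψ d) (hx : x ∈ Icc a b)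
    (hne : x ≠ d) : ψ x < ψ d := by
  obtain ⟨-, -, -, -, hd, hi, hdec⟩ := h
  rcases hne.lt_or_gt with l | l
  · exact hi ⟨hx.1, l.le⟩ ⟨hd.1.le, le_rfl⟩ l
  · exact hdec ⟨le_rfl, hd.2.le⟩ ⟨l.le, hx.2⟩ l

theorem tendsto_turning (hF : IsUNDS a b f cF) (hφ : IsUnimodal a b φ c)
    (hu : TendstoUniformlyOn (fun n => f n) φ atTop (Icc a b)) :
    Tendsto cF atTop (𝓝 c) := by
  have hc := hφ.2.2.2.2.1
  have hpt : ∀ x ∈ Icc a b, Tendsto (fun n => f n x) atTop (𝓝 (φ x)) :=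
    fun x hx => hu.tendsto_at hx
  have hcc := hpt c (Ioo_subset_Icc_self hc)
  refine tendsto_order.2 ⟨fun l hl => ?_, fun r hr => ?_⟩
  · obtain ⟨p, hp₁, hp₂⟩ := exists_between (max_lt hl hc.1)
    rw [max_lt_iff] at hp₁
    have hp : p ∈ Icc a b := ⟨hp₁.2.le, by linarith [hc.2]⟩
    filter_upwards [(hpt p hp).eventually_lt hcc (lt_apply_turning hφ hp hp₂.ne)] with n hn
    by_contra! hle
    have hn' := (hF.2 n).2.2.2.2.2.2 ⟨by linarith, hp.2⟩ ⟨by linarith, hc.2.le⟩ hp₂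
    linarith
  · obtain ⟨p, hp₁, hp₂⟩ := exists_between (lt_min hr hc.2)
    rw [lt_min_iff] at hp₂
    have hp : p ∈ Icc a b := ⟨by linarith [hc.1], hp₂.2.le⟩
    filter_upwards [(hpt p hp).eventually_lt hcc (lt_apply_turning hφ hp hp₁.ne')] with n hn
    by_contra! hle
    have hn' := (hF.2 n).2.2.2.2.2.1 ⟨hc.1.le, by linarith⟩ ⟨hp.1, by linarith⟩ hp₁
    linarith

theorem tendsto_iterFrom (hF : IsUNDS a b f cF) (hφ : IsUnimodal a b φ c)
    (hu : TendstoUniformlyOn (fun n => f n) φ atTop (Icc a b))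
    {n : ℕ → ℕ} (hn : Tendsto n atTop atTop) {z : ℕ → ℝ} {x : ℝ}
    (hz : ∀ k, z k ∈ Icc a b) (hx : x ∈ Icc a b) (hzx : Tendsto z atTop (𝓝 x)) (ℓ : ℕ) :
    Tendsto (fun k => iterFrom f (n k) ℓ (z k)) atTop (𝓝 (φ^[ℓ] x)) := by
  induction ℓ with
  | zero => exact hzx
  | succ m ih =>
    have hu' : TendstoUniformlyOn (fun k => f (n k + m)) φ atTop (Icc a b) :=
      fun u hu₀ => (tendsto_atTop_mono (fun k => Nat.le_add_right (n k) m) hn).eventually (hu u hu₀)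
    rw [Function.iterate_succ_apply']
    exact hu'.tendsto_comp (hφ.1 _ (hφ.2.1.iterate m hx))
      (tendsto_nhdsWithin_iff.2 ⟨ih, Eventually.of_forall fun k => iterFrom_mem hF (hz k) m⟩)

/-- Iterates of a unimodal map with nonperiodic turning point cross the turning point
transversally at each preimage of it. -/
theorem exists_straddle (hφ : IsUnimodal a b φ c) (hper : ∀ m : ℕ, 1 ≤ m → φ^[m] c ≠ c)
    (ℓ : ℕ) :
    ∀ {u p v : ℝ}, a ≤ u → v ≤ b → u < p → p < v → φ^[ℓ] p = c →
      ∃ p₁ ∈ Ioo u p, ∃ p₂ ∈ Ioo p v,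
        (φ^[ℓ] p₁ < c ∧ c < φ^[ℓ] p₂) ∨ (φ^[ℓ] p₂ < c ∧ c < φ^[ℓ] p₁) := by
  induction ℓ with
  | zero =>
    intro u p v _ _ hup hpv hp
    obtain ⟨p₁, h₁⟩ := exists_between hup
    obtain ⟨p₂, h₂⟩ := exists_between hpv
    simp only [Function.iterate_zero, id] at hp ⊢
    subst hp
    exact ⟨p₁, h₁, p₂, h₂, Or.inl ⟨h₁.2, h₂.1⟩⟩
  | succ m ih =>
    intro u p v hu hv hup hpv hp
    have hpc : p ≠ c := fun h => hper (m + 1) (by omega) (h ▸ hp)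
    obtain ⟨hcont, hm, -, -, hc, hinc, hdec⟩ := hφ
    simp only [Function.iterate_succ_apply] at hp ⊢
    rcases hpc.lt_or_gt with l | l
    · obtain ⟨w, hpw, hw⟩ := exists_between (lt_min hpv l)
      rw [lt_min_iff] at hw
      have mu : u ∈ Icc a c := ⟨hu, by linarith⟩
      have mp : p ∈ Icc a c := ⟨by linarith, l.le⟩
      have mw : w ∈ Icc a c := ⟨by linarith, hw.2.le⟩
      have hc' : ∀ {s t}, a ≤ s → t ≤ w → ContinuousOn φ (Icc s t) := fun hs ht =>
        hcont.mono (Icc_subset_Icc hs (by linarith [hw.2, hc.2]))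
      obtain ⟨q₁, h₁, q₂, h₂, h⟩ := ih (hm ⟨hu, by linarith⟩).1
        (hm ⟨mw.1, by linarith [hw.1]⟩).2 (hinc mu mp hup) (hinc mp mw hpw) hp
      obtain ⟨p₁, hp₁, rfl⟩ := intermediate_value_Ioo hup.le (hc' hu hpw.le) h₁
      obtain ⟨p₂, hp₂, rfl⟩ := intermediate_value_Ioo hpw.le (hc' mp.1 le_rfl) h₂
      exact ⟨p₁, hp₁, p₂, ⟨hp₂.1, hp₂.2.trans hw.1⟩, h⟩
    · obtain ⟨w, hw, hpw⟩ := exists_between (max_lt hup l)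
      rw [max_lt_iff] at hw
      have mv : v ∈ Icc c b := ⟨by linarith, hv⟩
      have mp : p ∈ Icc c b := ⟨l.le, by linarith⟩
      have mw : w ∈ Icc c b := ⟨hw.2.le, by linarith⟩
      have hc' : ∀ {s t}, w ≤ s → t ≤ b → ContinuousOn φ (Icc s t) := fun hs ht =>
        hcont.mono (Icc_subset_Icc (by linarith [hw.2, hc.1]) ht)
      obtain ⟨q₁, h₁, q₂, h₂, h⟩ := ih (hm ⟨by linarith, hv⟩).1
        (hm ⟨by linarith [hw.1], mw.2⟩).2 (hdec mp mv hpv) (hdec mw mp hpw) hp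
      obtain ⟨p₂, hp₂, rfl⟩ := intermediate_value_Ioo' hpv.le (hc' hpw.le hv) h₁
      obtain ⟨p₁, hp₁, rfl⟩ := intermediate_value_Ioo' hpw.le (hc' le_rfl mp.2) h₂
      exact ⟨p₁, ⟨hw.1.trans hp₁.1, hp₁.2⟩, p₂, hp₂, h.symm⟩

/-- Every interval contains preimages of the turning point at two different levels. -/
theorem exists_two_levels (hφ : IsUnimodal a b φ c) (hper : ∀ m : ℕ, 1 ≤ m → φ^[m] c ≠ c)
    (hd : Icc a b ⊆ closure (critSetMap a b φ c)) {u v : ℝ} (hu : a ≤ u) (hv : v ≤ b)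
    (huv : u < v) :
    ∃ p ∈ Ioo u v, ∃ q ∈ Ioo u v, ∃ i j : ℕ, i ≠ j ∧ φ^[i] p = c ∧ φ^[j] q = c := by
  obtain ⟨p, ⟨-, i, hi⟩, hp⟩ := exists_mem_Ioo_of_dense hd hu hv huv
  obtain ⟨p₁, hp₁, p₂, -, hs⟩ := exists_straddle hφ hper i hu hv hp.1 hp.2 hi
  have hne : φ^[i] p₁ ≠ c := by rcases hs with h | h; exacts [h.1.ne, h.2.ne']
  have hnhds : Icc a b ∈ 𝓝 p₁ := Icc_mem_nhds (by linarith [hp₁.1]) (by linarith [hp₁.2, hp.2])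
  have hcont : ContinuousAt φ^[i] p₁ :=
    (hφ.1.iterate hφ.2.1 i).continuousAt hnhds
  obtain ⟨q, ⟨hq, hqp⟩, -, j, hj⟩ := mem_closure_iff_nhds.1 (hd (mem_of_mem_nhds hnhds)) _
    (inter_mem (hcont.eventually_ne hne) (Ioo_mem_nhds hp₁.1 (hp₁.2.trans hp.2)))
  exact ⟨p, hp, q, hqp, i, j, by rintro rfl; exact hq hj, hi, hj⟩

/-- Preimages of the limiting turning point persist for the nonautonomous system. -/
theorem eventually_exists_precritical (hF : IsUNDS a b f cF) (hφ : IsUnimodal a b φ c)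
    (hper : ∀ m : ℕ, 1 ≤ m → φ^[m] c ≠ c)
    (hu : TendstoUniformlyOn (fun n => f n) φ atTop (Icc a b)) {ℓ : ℕ} {u p v : ℝ}
    (hau : a ≤ u) (hvb : v ≤ b) (hp : p ∈ Ioo u v) (hpc : φ^[ℓ] p = c) :
    ∃ s t : ℝ, u < s ∧ t < v ∧
      ∀ᶠ n in atTop, ∃ q ∈ Icc s t, iterFrom f n ℓ q = cF (n + ℓ) := by
  obtain ⟨p₁, h₁, p₂, h₂, hs⟩ := exists_straddle hφ hper ℓ hau hvb hp.1 hp.2 hpc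
  have m₁ : p₁ ∈ Icc a b := ⟨by linarith [h₁.1], by linarith [h₁.2, hp.2]⟩
  have m₂ : p₂ ∈ Icc a b := ⟨by linarith [h₂.1, hp.1], by linarith [h₂.2]⟩
  have hle : p₁ ≤ p₂ := by linarith [h₁.2, h₂.1]
  have hsub : Icc p₁ p₂ ⊆ Icc a b := Icc_subset_Icc m₁.1 m₂.2
  have t₁ := tendsto_iterFrom hF hφ hu tendsto_id (fun _ => m₁) m₁ tendsto_const_nhds ℓ
  have t₂ := tendsto_iterFrom hF hφ hu tendsto_id (fun _ => m₂) m₂ tendsto_const_nhds ℓ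
  have tc := (tendsto_turning hF hφ hu).comp (tendsto_add_atTop_nat ℓ)
  refine ⟨p₁, p₂, h₁.1, h₂.2, ?_⟩
  rcases hs with hs | hs
  · filter_upwards [t₁.eventually_lt tc hs.1, tc.eventually_lt t₂ hs.2] with n e₁ e₂
    exact intermediate_value_Icc hle ((continuousOn_iterFrom hF n ℓ).mono hsub) ⟨e₁.le, e₂.le⟩
  · filter_upwards [t₂.eventually_lt tc hs.1, tc.eventually_lt t₁ hs.2] with n e₁ e₂
    exact intermediate_value_Icc' hle ((continuousOn_iterFrom hF n ℓ).mono hsub) ⟨e₁.le, e₂.le⟩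

end Limit

theorem equicontinuous_of_precritical {a b a' b' : ℝ} {f g : ℕ → ℝ → ℝ} {cF cG : ℕ → ℝ}
    (hF : IsUNDS a b f cF) (hG : IsUNDS a' b' g cG)
    (hLF : LimitProperty a b f cF) (hLG : LimitProperty a' b' g cG) {h : ℕ → ℝ → ℝ}
    (hmono : ∀ n, StrictMonoOn (h n) (Icc a b)) (hcont : ∀ n, ContinuousOn (h n) (Icc a b))
    (hmaps : ∀ n, MapsTo (h n) (Icc a b) (Icc a' b'))
    (hsurj : ∀ n, SurjOn (h n) (Icc a b) (Icc a' b'))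
    (hcrit : ∀ n, ∀ x ∈ Icc a b, ∀ ℓ, iterFrom g n ℓ (h n x) = cG (n + ℓ) →
      iterFrom f n ℓ x = cF (n + ℓ)) :
    ∀ ε > (0:ℝ), ∃ δ > (0:ℝ), ∀ n, ∀ x ∈ Icc a b, ∀ y ∈ Icc a b,
      |x - y| < δ → |h n x - h n y| < ε := by
  obtain ⟨φ, c, hφ, hper, hunif, -, -⟩ := hLF
  obtain ⟨ψ, d, hψ, hperψ, hunifψ, -, hdψ⟩ := hLG
  intro ε hε
  by_contra! hcon
  have hseq : ∀ k : ℕ, ∃ n, ∃ x ∈ Icc a b, ∃ y ∈ Icc a b,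
      x < y ∧ y - x < 1 / ((k : ℝ) + 1) ∧ ε ≤ h n y - h n x := by
    intro k
    obtain ⟨n, x, hx, y, hy, hxy, hε'⟩ := hcon (1 / ((k : ℝ) + 1)) (by positivity)
    rcases lt_trichotomy x y with l | rfl | l
    · have := hmono n hx hy l
      rw [abs_sub_comm, abs_of_pos (by linarith)] at hxy hε'
      exact ⟨n, x, hx, y, hy, l, hxy, hε'⟩
    · simp at hε'
      linarith
    · have := hmono n hy hx l
      rw [abs_of_pos (by linarith)] at hxy hε'
      exact ⟨n, y, hy, x, hx, l, hxy, hε'⟩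
  choose n x hx y hy hlt hδ hge using hseq
  have hzero : Tendsto (fun k : ℕ => 1 / ((k : ℝ) + 1)) atTop (𝓝 0) :=
    tendsto_one_div_add_atTop_nhds_zero_nat
  have hn : Tendsto n atTop atTop := by
    refine tendsto_atTop.2 fun N => ?_
    have hall : ∀ m ∈ Finset.range N, ∀ᶠ k in atTop, n k ≠ m := by
      intro m _
      obtain ⟨δ, hδ₀, hδ'⟩ := Metric.uniformContinuousOn_iff.1
        (isCompact_Icc.uniformContinuousOn_of_continuous (hcont m)) ε hε
      filter_upwards [hzero.eventually_lt_const hδ₀] with k hk hnk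
      have := hδ' (y k) (hy k) (x k) (hx k)
        (by rw [Real.dist_eq, abs_of_pos (by linarith [hlt k])]; linarith [hδ k])
      rw [Real.dist_eq] at this
      have h₁ := hge k
      rw [hnk] at h₁
      linarith [le_abs_self (h m (y k) - h m (x k))]
    filter_upwards [(Finset.eventually_all _).2 hall] with k hk
    by_contra! hkN
    exact hk (n k) (Finset.mem_range.2 hkN) rfl
  obtain ⟨⟨x₀, u, v⟩, hmem, σ, hσ, hlim⟩ :=
    (isCompact_Icc.prod (isCompact_Icc.prod isCompact_Icc)).tendsto_subseq
      (x := fun k => (x k, h (n k) (x k), h (n k) (y k)))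
      (s := Icc a b ×ˢ (Icc a' b' ×ˢ Icc a' b'))
      (fun k => ⟨hx k, hmaps _ (hx k), hmaps _ (hy k)⟩)
  obtain ⟨hx₀, hu, hv⟩ := hmem
  have lx : Tendsto (fun k => x (σ k)) atTop (𝓝 x₀) := (continuous_fst.tendsto _).comp hlim
  have lu : Tendsto (fun k => h (n (σ k)) (x (σ k))) atTop (𝓝 u) :=
    ((continuous_fst.comp continuous_snd).tendsto _).comp hlim
  have lv : Tendsto (fun k => h (n (σ k)) (y (σ k))) atTop (𝓝 v) :=
    ((continuous_snd.comp continuous_snd).tendsto _).comp hlim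
  have ly : Tendsto (fun k => y (σ k)) atTop (𝓝 x₀) := by
    have : Tendsto (fun k => x (σ k) + 1 / ((σ k : ℝ) + 1)) atTop (𝓝 x₀) := by
      simpa using lx.add (hzero.comp hσ.tendsto_atTop)
    exact tendsto_of_tendsto_of_tendsto_of_le_of_le lx this (fun k => (hlt _).le)
      fun k => by dsimp only; linarith [hδ (σ k)]
  have hnσ : Tendsto (fun k => n (σ k)) atTop atTop := hn.comp hσ.tendsto_atTop
  have huv : u < v := by
    have := ge_of_tendsto' (lv.sub lu) (fun k => hge (σ k))
    linarith
  have key : ∀ p ∈ Ioo u v, ∀ ℓ, ψ^[ℓ] p = d → φ^[ℓ] x₀ = c := by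
    intro p hp ℓ hpd
    obtain ⟨s, t, hs, ht, hev⟩ :=
      eventually_exists_precritical hG hψ hperψ hunifψ hu.1 hv.2 hp hpd
    have hz : ∀ᶠ k in atTop, ∃ z ∈ Icc a b, z ∈ Icc (x (σ k)) (y (σ k)) ∧
        iterFrom f (n (σ k)) ℓ z = cF (n (σ k) + ℓ) := by
      filter_upwards [hnσ.eventually hev, lu.eventually_lt_const hs,
        lv.eventually_const_lt ht] with k ⟨q, hq, hqc⟩ hks hkt
      have e₁ := hmaps (n (σ k)) (hx (σ k))
      have e₂ := hmaps (n (σ k)) (hy (σ k))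
      obtain ⟨z, hz, rfl⟩ := hsurj (n (σ k))
        (show q ∈ Icc a' b' from ⟨by linarith [hq.1, e₁.1], by linarith [hq.2, e₂.2]⟩)
      refine ⟨z, hz, ⟨?_, ?_⟩, hcrit _ _ hz _ hqc⟩
      · exact ((hmono _).le_iff_le (hx _) hz).1 (by linarith [hq.1])
      · exact ((hmono _).le_iff_le hz (hy _)).1 (by linarith [hq.2])
    have hz' : ∀ k, ∃ z ∈ Icc a b, z ∈ Icc (x (σ k)) (y (σ k)) ∧
        ((∃ z ∈ Icc a b, z ∈ Icc (x (σ k)) (y (σ k)) ∧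
          iterFrom f (n (σ k)) ℓ z = cF (n (σ k) + ℓ)) →
          iterFrom f (n (σ k)) ℓ z = cF (n (σ k) + ℓ)) := by
      intro k
      by_cases hk : ∃ z ∈ Icc a b, z ∈ Icc (x (σ k)) (y (σ k)) ∧
          iterFrom f (n (σ k)) ℓ z = cF (n (σ k) + ℓ)
      · obtain ⟨z, h₁, h₂, h₃⟩ := hk
        exact ⟨z, h₁, h₂, fun _ => h₃⟩
      · exact ⟨x (σ k), hx _, left_mem_Icc.2 (hlt _).le, fun h => absurd h hk⟩
    choose z hz₁ hz₂ hz₃ using hz'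
    have lz : Tendsto z atTop (𝓝 x₀) :=
      tendsto_of_tendsto_of_tendsto_of_le_of_le lx ly (fun k => (hz₂ k).1) fun k => (hz₂ k).2
    have l₁ := tendsto_iterFrom hF hφ hunif hnσ hz₁ hx₀ lz ℓ
    have l₂ : Tendsto (fun k => cF (n (σ k) + ℓ)) atTop (𝓝 c) :=
      (tendsto_turning hF hφ hunif).comp
        (tendsto_atTop_mono (fun k => Nat.le_add_right (n (σ k)) ℓ) hnσ)
    exact tendsto_nhds_unique (l₁.congr' (hz.mono fun k hk => hz₃ k hk)) l₂
  obtain ⟨p, hp, q, hq, i, j, hij, hi, hj⟩ := exists_two_levels hψ hperψ hdψ hu.1 hv.2 huv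
  have hne : ∀ i j : ℕ, i < j → φ^[i] x₀ = c → φ^[j] x₀ ≠ c := by
    intro i j hij hi hj
    refine hper (j - i) (by omega) ?_
    rw [← hi, ← Function.iterate_add_apply, show j - i + i = j by omega, hj, hi]
  rcases hij.lt_or_gt with l | l
  · exact hne i j l (key p hp i hi) (key q hq j hj)
  · exact hne j i l (key q hq j hj) (key p hp i hi)

theorem topConjugate_of_sameKneading {a b a' b' : ℝ} {f g : ℕ → ℝ → ℝ} {cF cG : ℕ → ℝ}
    (hF : IsUNDS a b f cF) (hG : IsUNDS a' b' g cG)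
    (hLF : LimitProperty a b f cF) (hLG : LimitProperty a' b' g cG)
    (hk : SameKneading f cF g cG) : TopConjugate a b a' b' f g := by
  have hdF : ∀ n, Icc a b ⊆ closure (critSet a b f cF n) := by
    obtain ⟨_, _, _, _, _, hd, _⟩ := hLF
    exact hd
  have hdG : ∀ n, Icc a' b' ⊆ closure (critSet a' b' g cG n) := by
    obtain ⟨_, _, _, _, _, hd, _⟩ := hLG
    exact hd
  have hk' : SameKneading g cG f cF := fun n ℓ => ⟨(hk n ℓ).1.symm, (hk n ℓ).2.symm⟩
  choose h k hm km ht kt hkh hhk heq using exists_conjugating_family hF hG hdF hdG hk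
  have hs : ∀ n, SurjOn (h n) (Icc a b) (Icc a' b') := fun n y hy => ⟨_, kt n hy, hhk n y hy⟩
  have ks : ∀ n, SurjOn (k n) (Icc a' b') (Icc a b) := fun n x hx => ⟨_, ht n hx, hkh n x hx⟩
  have hc := fun n => continuousOn_of_strictMonoOn_of_surjOn (hm n) (ht n) (hs n)
  have kc := fun n => continuousOn_of_strictMonoOn_of_surjOn (km n) (kt n) (ks n)
  have keq : ∀ n, ∀ x ∈ Icc a b, ∀ y ∈ Icc a' b', SameItinerary f cF g cG n x y → k n y = x := by
    intro n x hx y hy hxy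
    rw [← heq n x hx y hy hxy, hkh n x hx]
  have hcrit : ∀ n, ∀ x ∈ Icc a b, ∀ ℓ, iterFrom g n ℓ (h n x) = cG (n + ℓ) →
      iterFrom f n ℓ x = cF (n + ℓ) := by
    intro n x hx ℓ hℓ
    obtain ⟨z, hz, hxz⟩ := exists_sameItinerary hG hF hdG hk' ℓ (ht n hx) hℓ
    have := keq n z hz _ (ht n hx) hxz.symm
    rw [hkh n x hx] at this
    exact this ▸ (hxz ℓ).2.1 hℓ
  have kcrit : ∀ n, ∀ y ∈ Icc a' b', ∀ ℓ, iterFrom f n ℓ (k n y) = cF (n + ℓ) →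
      iterFrom g n ℓ y = cG (n + ℓ) := by
    intro n y hy ℓ hℓ
    obtain ⟨z, hz, hyz⟩ := exists_sameItinerary hF hG hdF hk ℓ (kt n hy) hℓ
    have := heq n _ (kt n hy) z hz hyz
    rw [hhk n y hy] at this
    exact this ▸ (hyz ℓ).2.1 hℓ
  refine ⟨h, hm, hc, fun n => ⟨ht n, (hm n).injOn, hs n⟩,
    equicontinuous_of_precritical hF hG hLF hLG hm hc ht hs hcrit, ?_, ?_⟩
  · intro ε hε
    obtain ⟨δ, hδ, H⟩ := equicontinuous_of_precritical hG hF hLG hLF km kc kt ks kcrit ε hε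
    refine ⟨δ, hδ, fun n x hx y hy hxy => ?_⟩
    have := H n _ (ht n hx) _ (ht n hy) hxy
    rwa [hkh n x hx, hkh n y hy] at this
  · intro n
    have hsub : critSet a b f cF n ⊆ Icc a b := fun x hx => hx.1
    have : EqOn (fun x => h (n + 1) (f n x)) (fun x => g n (h n x)) (critSet a b f cF n) := by
      rintro x ⟨hx, ℓ, hℓ⟩
      obtain ⟨y, hy, hxy⟩ := exists_sameItinerary hF hG hdF hk ℓ hx hℓ
      dsimp only
      rw [heq n x hx y hy hxy]
      exact heq (n + 1) _ ((hF.2 n).2.1 hx) _ ((hG.2 n).2.1 hy) hxy.shift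
    exact this.of_subset_closure ((hc (n + 1)).comp (hF.2 n).1 (hF.2 n).2.1)
      ((hG.2 n).1.comp (hc n) (ht n)) hsub (hdF n)

theorem sameKneading_of_topConjugate {a b a' b' : ℝ} {f g : ℕ → ℝ → ℝ} {cF cG : ℕ → ℝ}
    (hF : IsUNDS a b f cF) (hG : IsUNDS a' b' g cG)
    (hc : TopConjugate a b a' b' f g) : SameKneading f cF g cG := by
  obtain ⟨h, hm, -, hb, -, -, hconj⟩ := hc
  have memF : ∀ n, cF n ∈ Icc a b := fun n => Ioo_subset_Icc_self (hF.2 n).2.2.2.2.1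
  have memG : ∀ n, cG n ∈ Icc a' b' := fun n => Ioo_subset_Icc_self (hG.2 n).2.2.2.2.1
  have hturn : ∀ n, h n (cF n) = cG n := by
    intro n
    obtain ⟨x, hx, hxc⟩ := (hb n).surjOn (memG n)
    by_contra hne
    have hxne : x ≠ cF n := by rintro rfl; exact hne hxc
    have h₁ := lt_apply_turning (hG.2 n) ((hb n).mapsTo (memF n)) hne
    have h₂ := hm (n + 1) ((hF.2 n).2.1 hx) ((hF.2 n).2.1 (memF n))
      (lt_apply_turning (hF.2 n) hx hxne)
    rw [hconj n x hx, hconj n _ (memF n), hxc] at h₂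
    exact lt_asymm h₁ h₂
  have hiter : ∀ n ℓ, h (n + ℓ) (iterFrom f n ℓ (cF n)) = iterFrom g n ℓ (cG n) := by
    intro n ℓ
    induction ℓ with
    | zero => exact hturn n
    | succ m ih =>
      rw [iterFrom, iterFrom, ← ih]
      exact hconj (n + m) _ (iterFrom_mem hF (memF n) m)
  intro n ℓ
  have hmem := iterFrom_mem (n := n) hF (memF n) ℓ
  rw [← hiter, ← hturn (n + ℓ)]
  exact ⟨((hm _).lt_iff_lt hmem (memF _)).symm, ((hm _).eq_iff_eq hmem (memF _)).symm⟩

end UnimodalNDS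

/-- Two unimodal nonautonomous discrete dynamical systems, both satisfying the limit
property, are topologically conjugate if and only if they have the same kneading
sequence. -/
theorem topConjugate_iff_sameKneading
    (aF bF aG bG : ℝ) (f g : ℕ → ℝ → ℝ) (cF cG : ℕ → ℝ)
    (hF : IsUNDS aF bF f cF) (hG : IsUNDS aG bG g cG)
    (hLF : LimitProperty aF bF f cF) (hLG : LimitProperty aG bG g cG) :
    TopConjugate aF bF aG bG f g ↔ SameKneading f cF g cG := by
  exact ⟨UnimodalNDS.sameKneading_of_topConjugate hF hG,
    UnimodalNDS.topConjugate_of_sameKneading hF hG hLF hLG⟩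
end
end

section
/- Let (J^ℱ,(f_n)) and (J^𝒢,(g_n)) be two unimodal nonautonomous discrete dynamical systems. If (J^ℱ,(f_n)) and (J^𝒢,(g_n)) are topologically conjugate, then they have the same kneading sequence. -/
open Set

noncomputable section

/-- The turning point is the unique maximum point of a unimodal map. -/
theorem IsUNDS.apply_lt_apply_turningPoint {a b : ℝ} {f : ℕ → ℝ → ℝ} {c : ℕ → ℝ}
    (hf : IsUNDS a b f c) (n : ℕ) {x : ℝ} (hx : x ∈ Icc a b) (hne : x ≠ c n) :
    f n x < f n (c n) := by
  obtain ⟨-, -, -, -, hc, hmono, hanti⟩ := hf.2 n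
  rcases lt_or_gt_of_ne hne with hlt | hgt
  · exact hmono ⟨hx.1, hlt.le⟩ ⟨hc.1.le, le_rfl⟩ hlt
  · exact hanti ⟨le_rfl, hc.2.le⟩ ⟨hgt.le, hx.2⟩ hgt

theorem IsUNDS.turningPoint_mem {a b : ℝ} {f : ℕ → ℝ → ℝ} {c : ℕ → ℝ}
    (hf : IsUNDS a b f c) (n : ℕ) : c n ∈ Icc a b :=
  Ioo_subset_Icc_self (hf.2 n).2.2.2.2.1

theorem IsUNDS.mapsTo {a b : ℝ} {f : ℕ → ℝ → ℝ} {c : ℕ → ℝ}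
    (hf : IsUNDS a b f c) (n : ℕ) : MapsTo (f n) (Icc a b) (Icc a b) :=
  (hf.2 n).2.1

theorem iterFrom_mem {f : ℕ → ℝ → ℝ} {s : Set ℝ} (hf : ∀ n, MapsTo (f n) s s)
    (n ℓ : ℕ) {x : ℝ} (hx : x ∈ s) : iterFrom f n ℓ x ∈ s := by
  induction ℓ with
  | zero => exact hx
  | succ ℓ ih => exact hf (n + ℓ) ih

/-- A semiconjugacy of nonautonomous systems intertwines all their iterates. -/
theorem map_iterFrom {f g h : ℕ → ℝ → ℝ} {s : Set ℝ} (hf : ∀ n, MapsTo (f n) s s)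
    (hfg : ∀ n, ∀ x ∈ s, h (n + 1) (f n x) = g n (h n x))
    (n ℓ : ℕ) {x : ℝ} (hx : x ∈ s) :
    h (n + ℓ) (iterFrom f n ℓ x) = iterFrom g n ℓ (h n x) := by
  induction ℓ with
  | zero => rfl
  | succ ℓ ih =>
    calc h (n + ℓ + 1) (f (n + ℓ) (iterFrom f n ℓ x))
        = g (n + ℓ) (h (n + ℓ) (iterFrom f n ℓ x)) := hfg _ _ (iterFrom_mem hf n ℓ hx)
      _ = g (n + ℓ) (iterFrom g n ℓ (h n x)) := by rw [ih]

/-- An order-preserving conjugacy sends turning points to turning points. -/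
theorem map_turningPoint {aF bF aG bG : ℝ} {f g h : ℕ → ℝ → ℝ} {cF cG : ℕ → ℝ}
    (hF : IsUNDS aF bF f cF) (hG : IsUNDS aG bG g cG)
    (hmono : ∀ n, StrictMonoOn (h n) (Icc aF bF))
    (hbij : ∀ n, BijOn (h n) (Icc aF bF) (Icc aG bG))
    (hfg : ∀ n, ∀ x ∈ Icc aF bF, h (n + 1) (f n x) = g n (h n x)) (n : ℕ) :
    h n (cF n) = cG n := by
  have hc := hF.turningPoint_mem n
  obtain ⟨x, hx, hxc⟩ := (hbij n).surjOn (hG.turningPoint_mem n)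
  by_contra hne
  have hxne : x ≠ cF n := fun hxF => hne (hxF ▸ hxc)
  have hlt := hmono (n + 1) (hF.mapsTo n hx) (hF.mapsTo n hc)
    (hF.apply_lt_apply_turningPoint n hx hxne)
  rw [hfg n x hx, hfg n _ hc, hxc] at hlt
  exact lt_asymm hlt (hG.apply_lt_apply_turningPoint n ((hbij n).mapsTo hc) hne)

/-- If two unimodal nonautonomous discrete dynamical systems are topologically conjugate,
then they have the same kneading sequence. -/
theorem sameKneading_of_topConjugate
    (aF bF aG bG : ℝ) (f g : ℕ → ℝ → ℝ) (cF cG : ℕ → ℝ)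
    (hF : IsUNDS aF bF f cF) (hG : IsUNDS aG bG g cG)
    (hconj : TopConjugate aF bF aG bG f g) :
    SameKneading f cF g cG := by
  obtain ⟨h, hmono, -, hbij, -, -, hfg⟩ := hconj
  intro n ℓ
  have hc := hF.turningPoint_mem
  have hturn := map_turningPoint hF hG hmono hbij hfg
  have hmem := iterFrom_mem hF.mapsTo n ℓ (hc n)
  rw [← hturn n, ← hturn (n + ℓ), ← map_iterFrom hF.mapsTo hfg n ℓ (hc n)]
  exact ⟨((hmono (n + ℓ)).lt_iff_lt hmem (hc _)).symm,
    ((hmono (n + ℓ)).injOn.eq_iff hmem (hc _)).symm⟩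
end
end

section
/- Let (J^ℱ,(f_n)) and (J^𝒢,(g_n)) be two unimodal nonautonomous discrete dynamical systems with kneading sequences 𝕍(ℱ) and 𝕍(𝒢). If 𝕍(ℱ)=𝕍(𝒢), then (J^ℱ,(f_n)) and (J^𝒢,(g_n)) are combinatorially equivalent. -/
open Set

noncomputable section

/-- Combinatorial equivalence: a family of order-preserving bijections
`h n : 𝒞_n(ℱ) → 𝒞_n(𝒢)` with `h (n+1) ∘ f n = g n ∘ h n` on `𝒞_n(ℱ) \ {c_n^ℱ}`. -/
def CombEquiv (aF bF aG bG : ℝ) (f : ℕ → ℝ → ℝ) (cF : ℕ → ℝ)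
    (g : ℕ → ℝ → ℝ) (cG : ℕ → ℝ) : Prop :=
  ∃ h : ℕ → ℝ → ℝ,
    (∀ n, StrictMonoOn (h n) (critSet aF bF f cF n)) ∧
    (∀ n, BijOn (h n) (critSet aF bF f cF n) (critSet aG bG g cG n)) ∧
    (∀ n, ∀ x ∈ critSet aF bF f cF n \ {cF n}, h (n + 1) (f n x) = g n (h n x))

/-- `x` under `f` and `y` under `g` have the same itinerary from time `n` on, relative to the
turning points. -/
def SameItinerary (f : ℕ → ℝ → ℝ) (cF : ℕ → ℝ) (g : ℕ → ℝ → ℝ) (cG : ℕ → ℝ)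
    (n : ℕ) (x y : ℝ) : Prop :=
  ∀ ℓ : ℕ,
    (iterFrom f n ℓ x < cF (n + ℓ) ↔ iterFrom g n ℓ y < cG (n + ℓ)) ∧
    (iterFrom f n ℓ x = cF (n + ℓ) ↔ iterFrom g n ℓ y = cG (n + ℓ))

theorem iterFrom_succ_left (f : ℕ → ℝ → ℝ) (n ℓ : ℕ) (x : ℝ) :
    iterFrom f n (ℓ + 1) x = iterFrom f (n + 1) ℓ (f n x) := by
  induction ℓ with
  | zero => rfl
  | succ k ih =>
    rw [iterFrom, ih, iterFrom, Nat.add_right_comm n 1 k, Nat.add_assoc n k 1]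

namespace SameItinerary

variable {f g : ℕ → ℝ → ℝ} {cF cG : ℕ → ℝ} {n : ℕ} {x y : ℝ}

theorem symm (h : SameItinerary f cF g cG n x y) : SameItinerary g cG f cF n y x :=
  fun ℓ => ⟨(h ℓ).1.symm, (h ℓ).2.symm⟩

theorem lt_iff (h : SameItinerary f cF g cG n x y) : x < cF n ↔ y < cG n := (h 0).1

theorem eq_iff (h : SameItinerary f cF g cG n x y) : x = cF n ↔ y = cG n := (h 0).2

theorem gt_iff (h : SameItinerary f cF g cG n x y) : cF n < x ↔ cG n < y := by
  have h₁ := h.lt_iff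
  have h₂ := h.eq_iff
  grind

theorem map (h : SameItinerary f cF g cG n x y) :
    SameItinerary f cF g cG (n + 1) (f n x) (g n y) := by
  intro ℓ
  have := h (ℓ + 1)
  rwa [iterFrom_succ_left, iterFrom_succ_left, ← Nat.add_assoc, Nat.add_right_comm] at this

theorem of_map (hlt : x < cF n ↔ y < cG n) (heq : x = cF n ↔ y = cG n)
    (h : SameItinerary f cF g cG (n + 1) (f n x) (g n y)) :
    SameItinerary f cF g cG n x y := by
  rintro (_ | ℓ)
  · exact ⟨hlt, heq⟩
  · rw [iterFrom_succ_left, iterFrom_succ_left, ← Nat.add_assoc, Nat.add_right_comm]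
    exact h ℓ

end SameItinerary

theorem map_mem_critSet {a b : ℝ} {f : ℕ → ℝ → ℝ} {c : ℕ → ℝ} (hf : IsUNDS a b f c) {n : ℕ}
    {x : ℝ} (hx : x ∈ critSet a b f c n) (hne : x ≠ c n) :
    f n x ∈ critSet a b f c (n + 1) := by
  obtain ⟨hxJ, _ | ℓ, hℓ⟩ := hx
  · exact absurd hℓ hne
  · refine ⟨(hf.2 n).2.1 hxJ, ℓ, ?_⟩
    rw [← iterFrom_succ_left, hℓ, Nat.add_right_comm n 1 ℓ, Nat.add_assoc]

section TwoSystems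

variable {aF bF aG bG : ℝ} {f g : ℕ → ℝ → ℝ} {cF cG : ℕ → ℝ}

/-- Itineraries determine the order of two points as soon as one of them hits a turning point. -/
theorem lt_of_sameItinerary (hF : IsUNDS aF bF f cF) (hG : IsUNDS aG bG g cG) (ℓ : ℕ) :
    ∀ {n : ℕ} {x x' y y' : ℝ}, x ∈ Icc aF bF → x' ∈ Icc aF bF → y ∈ Icc aG bG → y' ∈ Icc aG bG →
      SameItinerary f cF g cG n x y → SameItinerary f cF g cG n x' y' →
      (iterFrom f n ℓ x = cF (n + ℓ) ∨ iterFrom f n ℓ x' = cF (n + ℓ)) → x < x' → y < y' := by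
  induction ℓ with
  | zero =>
    intro n x x' y y' _ _ _ _ h h' hit hlt
    have h₁ := h.lt_iff
    have h₂ := h.eq_iff
    have h₃ := h'.lt_iff
    have h₄ := h'.eq_iff
    change x = cF n ∨ x' = cF n at hit
    grind
  | succ ℓ ih =>
    intro n x x' y y' hx hx' hy hy' h h' hit hlt
    obtain ⟨-, hfJ, -, -, -, hfL, hfR⟩ := hF.2 n
    obtain ⟨-, hgJ, -, -, -, hgL, hgR⟩ := hG.2 n
    rw [iterFrom_succ_left, iterFrom_succ_left, ← Nat.add_assoc, Nat.add_right_comm] at hit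
    have h₁ := h.lt_iff
    have h₂ := h.eq_iff
    have h₃ := h'.lt_iff
    have h₄ := h'.eq_iff
    by_cases hL : x' < cF n
    · have hyL := h₁.1 (hlt.trans hL)
      have hyL' := h₃.1 hL
      have hf := hfL ⟨hx.1, (hlt.trans hL).le⟩ ⟨hx'.1, hL.le⟩ hlt
      have hg := ih (hfJ hx) (hfJ hx') (hgJ hy) (hgJ hy') h.map h'.map hit hf
      exact (hgL.lt_iff_lt ⟨hy.1, hyL.le⟩ ⟨hy'.1, hyL'.le⟩).1 hg
    by_cases hR : cF n < x
    · have hyR := h.gt_iff.1 hR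
      have hyR' := h'.gt_iff.1 (hR.trans hlt)
      have hf := hfR ⟨hR.le, hx.2⟩ ⟨(hR.trans hlt).le, hx'.2⟩ hlt
      have hg := ih (hfJ hx') (hfJ hx) (hgJ hy') (hgJ hy) h'.map h.map hit.symm hf
      exact (hgR.lt_iff_gt ⟨hyR'.le, hy'.2⟩ ⟨hyR.le, hy.2⟩).1 hg
    grind

theorem sameItinerary_unique (hF : IsUNDS aF bF f cF) (hG : IsUNDS aG bG g cG)
    {n : ℕ} {x y y' : ℝ} (hx : x ∈ critSet aF bF f cF n) (hy : y ∈ Icc aG bG)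
    (hy' : y' ∈ Icc aG bG) (h : SameItinerary f cF g cG n x y)
    (h' : SameItinerary f cF g cG n x y') : y = y' := by
  obtain ⟨hxJ, ℓ, hℓ⟩ := hx
  have hit := (h ℓ).2.1 hℓ
  have hit' := (h' ℓ).2.1 hℓ
  rcases lt_trichotomy y y' with hlt | heq | hlt
  · exact (lt_irrefl x <| lt_of_sameItinerary hG hF ℓ hy hy' hxJ hxJ h.symm h'.symm
      (.inl hit) hlt).elim
  · exact heq
  · exact (lt_irrefl x <| lt_of_sameItinerary hG hF ℓ hy' hy hxJ hxJ h'.symm h.symm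
      (.inl hit') hlt).elim

theorem exists_sameItinerary_of_iterFrom_eq (hF : IsUNDS aF bF f cF) (hG : IsUNDS aG bG g cG)
    (hknead : SameKneading f cF g cG) (ℓ : ℕ) :
    ∀ {n : ℕ} {x : ℝ}, x ∈ Icc aF bF → iterFrom f n ℓ x = cF (n + ℓ) →
      ∃ y ∈ Icc aG bG, SameItinerary f cF g cG n x y := by
  induction ℓ with
  | zero =>
    intro n x _ hit
    obtain rfl : x = cF n := hit
    exact ⟨cG n, Ioo_subset_Icc_self (hG.2 n).2.2.2.2.1, hknead n⟩
  | succ ℓ ih =>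
    intro n x hx hit
    obtain ⟨-, hfJ, -, -, hcF, hfL, hfR⟩ := hF.2 n
    obtain ⟨hgc, hgJ, hga, hgb, hcG, hgL, hgR⟩ := hG.2 n
    have hcF' := Ioo_subset_Icc_self hcF
    have hcG' := Ioo_subset_Icc_self hcG
    have hkn : SameItinerary f cF g cG n (cF n) (cG n) := hknead n
    rw [iterFrom_succ_left, ← Nat.add_assoc, Nat.add_right_comm] at hit
    obtain ⟨z, hz, hxz⟩ := ih (hfJ hx) hit
    rcases lt_trichotomy x (cF n) with hlt | rfl | hlt
    · have hfx := hfL ⟨hx.1, hlt.le⟩ (right_mem_Icc.2 hcF'.1) hlt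
      have hzc := lt_of_sameItinerary hF hG ℓ (hfJ hx) (hfJ hcF') hz (hgJ hcG') hxz hkn.map
        (.inl hit) hfx
      obtain ⟨y, hy, rfl⟩ := intermediate_value_Icc hcG'.1
        (hgc.mono (Icc_subset_Icc_right hcG'.2)) ⟨hga.le.trans hz.1, hzc.le⟩
      have hyc : y < cG n := hy.2.lt_of_ne fun h => hzc.ne (h ▸ rfl)
      exact ⟨y, ⟨hy.1, hy.2.trans hcG'.2⟩,
        .of_map (iff_of_true hlt hyc) (iff_of_false hlt.ne hyc.ne) hxz⟩
    · exact ⟨cG n, hcG', hkn⟩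
    · have hfx := hfR (left_mem_Icc.2 hcF'.2) ⟨hlt.le, hx.2⟩ hlt
      have hzc := lt_of_sameItinerary hF hG ℓ (hfJ hx) (hfJ hcF') hz (hgJ hcG') hxz hkn.map
        (.inl hit) hfx
      obtain ⟨y, hy, rfl⟩ := intermediate_value_Icc' hcG'.2
        (hgc.mono (Icc_subset_Icc_left hcG'.1)) ⟨hgb.le.trans hz.1, hzc.le⟩
      have hyc : cG n < y := hy.1.lt_of_ne fun h => hzc.ne (h ▸ rfl)
      exact ⟨y, ⟨hcG'.1.trans hy.1, hy.2⟩,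
        .of_map (iff_of_false hlt.not_gt hyc.not_gt) (iff_of_false hlt.ne' hyc.ne') hxz⟩

theorem exists_sameItinerary (hF : IsUNDS aF bF f cF) (hG : IsUNDS aG bG g cG)
    (hknead : SameKneading f cF g cG) {n : ℕ} {x : ℝ} (hx : x ∈ critSet aF bF f cF n) :
    ∃ y ∈ critSet aG bG g cG n, SameItinerary f cF g cG n x y := by
  obtain ⟨hxJ, ℓ, hℓ⟩ := hx
  obtain ⟨y, hy, h⟩ := exists_sameItinerary_of_iterFrom_eq hF hG hknead ℓ hxJ hℓ
  exact ⟨y, ⟨hy, ℓ, (h ℓ).2.1 hℓ⟩, h⟩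

end TwoSystems

/-- Equality of kneading sequences implies combinatorial equivalence. -/
theorem combEquiv_of_sameKneading
    (aF bF aG bG : ℝ) (f g : ℕ → ℝ → ℝ) (cF cG : ℕ → ℝ)
    (hF : IsUNDS aF bF f cF) (hG : IsUNDS aG bG g cG)
    (hknead : SameKneading f cF g cG) :
    CombEquiv aF bF aG bG f cF g cG := by
  have hex : ∀ n x, ∃ y, x ∈ critSet aF bF f cF n →
      y ∈ critSet aG bG g cG n ∧ SameItinerary f cF g cG n x y := by
    intro n x
    by_cases hx : x ∈ critSet aF bF f cF n
    · obtain ⟨y, hy⟩ := exists_sameItinerary hF hG hknead hx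
      exact ⟨y, fun _ => hy⟩
    · exact ⟨0, fun h => absurd h hx⟩
  choose h hh using hex
  have hmono : ∀ n, StrictMonoOn (h n) (critSet aF bF f cF n) := by
    intro n x hx x' hx' hlt
    obtain ⟨ℓ, hℓ⟩ := hx.2
    exact lt_of_sameItinerary hF hG ℓ hx.1 hx'.1 (hh n x hx).1.1 (hh n x' hx').1.1
      (hh n x hx).2 (hh n x' hx').2 (.inl hℓ) hlt
  refine ⟨h, hmono, fun n => ⟨fun x hx => (hh n x hx).1, (hmono n).injOn, fun y hy => ?_⟩, ?_⟩
  · have hknead' : SameKneading g cG f cF :=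
      fun m ℓ => ⟨(hknead m ℓ).1.symm, (hknead m ℓ).2.symm⟩
    obtain ⟨x, hx, hyx⟩ := exists_sameItinerary hG hF hknead' hy
    exact ⟨x, hx, sameItinerary_unique hF hG hx (hh n x hx).1.1 hy.1 (hh n x hx).2 hyx.symm⟩
  · rintro n x ⟨hx, hne⟩
    have hfx := map_mem_critSet hF hx hne
    exact sameItinerary_unique hF hG hfx (hh (n + 1) _ hfx).1.1
      ((hG.2 n).2.1 (hh n x hx).1.1) (hh (n + 1) _ hfx).2 (hh n x hx).2.map
end
end

section
/- Let J=[a,b] and K=[c,d] be compact real intervals, let C⊆J and D⊆K with D dense in K, and let h:C→D be a strictly increasing bijection. Then there exists a monotone nondecreasing continuous surjective map H:J→K such that H(x)=h(x) for all x∈C. -/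
open Set

noncomputable section

/-- A monotone function into `[c,d]` whose range is dense in `[c,d]` is continuous. -/
theorem Monotone.continuous_of_Icc_subset_closure_range {H : ℝ → ℝ} {c d : ℝ}
    (hH : Monotone H) (hmem : ∀ x, H x ∈ Icc c d) (hdense : Icc c d ⊆ closure (range H)) :
    Continuous H := by
  let G : ℝ → Icc c d := fun x => ⟨H x, hmem x⟩
  have hG : Monotone G := fun x y hxy => hH hxy
  have hGdense : DenseRange G := by
    intro p
    rw [closure_subtype, ← range_comp]
    exact hdense p.2
  exact continuous_subtype_val.comp (hG.continuous_of_denseRange hGdense)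

/-- Let `J = [a,b]`, `K = [c,d]` be compact intervals, `C ⊆ J`, `D ⊆ K` with `D` dense
in `K`, and let `h : C → D` be a strictly increasing bijection. Then `h` extends to a
monotone nondecreasing continuous surjection `H : J → K`. -/
theorem exists_monotone_continuous_surjective_extension
    (a b c d : ℝ) (hab : a < b) (hcd : c < d)
    (C D : Set ℝ) (hC : C ⊆ Icc a b) (hD : D ⊆ Icc c d)
    (hDdense : Icc c d ⊆ closure D)
    (h : ℝ → ℝ) (hmono : StrictMonoOn h C) (hbij : BijOn h C D) :
    ∃ H : ℝ → ℝ,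
      MonotoneOn H (Icc a b) ∧
      ContinuousOn H (Icc a b) ∧
      MapsTo H (Icc a b) (Icc c d) ∧
      SurjOn H (Icc a b) (Icc c d) ∧
      (∀ x ∈ C, H x = h x) := by
  have hcD : ∀ x, c ∈ insert c (h '' (C ∩ Iic x)) := fun x => mem_insert _ _
  have hle : ∀ x, ∀ y ∈ insert c (h '' (C ∩ Iic x)), y ≤ d := by
    rintro x y (rfl | ⟨z, hz, rfl⟩)
    · exact hcd.le
    · exact (hD (hbij.mapsTo hz.1)).2
  have hbdd : ∀ x, BddAbove (insert c (h '' (C ∩ Iic x))) := fun x => ⟨d, hle x⟩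
  let H : ℝ → ℝ := fun x => sSup (insert c (h '' (C ∩ Iic x)))
  have hH : Monotone H := fun x y hxy =>
    csSup_le_csSup (hbdd y) ⟨c, hcD x⟩
      (insert_subset_insert (image_mono (inter_subset_inter_right C (Iic_subset_Iic.2 hxy))))
  have hmem : ∀ x, H x ∈ Icc c d := fun x =>
    ⟨le_csSup (hbdd x) (hcD x), csSup_le ⟨c, hcD x⟩ (hle x)⟩
  have hext : ∀ x ∈ C, H x = h x := by
    intro x hx
    refine le_antisymm (csSup_le ⟨c, hcD x⟩ ?_)
      (le_csSup (hbdd x) (mem_insert_of_mem _ ⟨x, ⟨hx, self_mem_Iic⟩, rfl⟩))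
    rintro y (rfl | ⟨z, hz, rfl⟩)
    · exact (hD (hbij.mapsTo hx)).1
    · exact hmono.monotoneOn hz.1 hx hz.2
  have hDrange : D ⊆ range H := by
    intro y hy
    obtain ⟨x, hx, rfl⟩ := hbij.surjOn hy
    exact ⟨x, hext x hx⟩
  have hcont : Continuous H :=
    hH.continuous_of_Icc_subset_closure_range hmem (hDdense.trans (closure_mono hDrange))
  have ha : H a ≤ c := by
    refine csSup_le ⟨c, hcD a⟩ ?_
    rintro y (rfl | ⟨z, hz, rfl⟩)
    · exact le_rfl
    · have hDz : D ⊆ Ici (h z) := by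
        intro y hy
        obtain ⟨x, hx, rfl⟩ := hbij.surjOn hy
        exact hmono.monotoneOn hz.1 hx (hz.2.trans (hC hx).1)
      exact closure_minimal hDz isClosed_Ici (hDdense (left_mem_Icc.2 hcd.le))
  have hb : d ≤ H b := by
    have hDb : D ⊆ Iic (H b) := by
      intro y hy
      obtain ⟨x, hx, rfl⟩ := hbij.surjOn hy
      exact (hext x hx).symm.trans_le (hH (hC hx).2)
    exact closure_minimal hDb isClosed_Iic (hDdense (right_mem_Icc.2 hcd.le))
  exact ⟨H, hH.monotoneOn _, hcont.continuousOn, fun x _ => hmem x,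
    (Icc_subset_Icc ha hb).trans (intermediate_value_Icc hab.le hcont.continuousOn), hext⟩
end
end
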